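/- Let X ∈ {0,1}^{n×k} be a k-clustering assignment matrix with k < n, and Z := X(XᵀX)⁻¹Xᵀ. Then Z satisfies the clique inequalities: for every subset I ⊆ [n] with |I| = k + 1, the sum ∑_{(i,j) ∈ I×I, i<j} Z_{ij} ≥ 1/(n − k + 1). -/

import Mathlib

open Matrix BigOperators Finset RealInnerProductSpace

/-- A `k`-clustering assignment matrix: entries in `{0,1}`, each row sums to `1`
(each data point is assigned to exactly one cluster), and each column sum is at
least `1` (no cluster is empty). -/
def IsAssignment {n k : ℕ} (X : Matrix (Fin n) (Fin k) ℝ) : Prop :=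
  (∀ i j, X i j = 0 ∨ X i j = 1) ∧
  (∀ i, ∑ j, X i j = 1) ∧
  (∀ j, 1 ≤ ∑ i, X i j)

/-- The matrix `Z = X (Xᵀ X)⁻¹ Xᵀ` associated to an assignment matrix `X`. -/
noncomputable def clusterMat {n k : ℕ} (X : Matrix (Fin n) (Fin k) ℝ) :
    Matrix (Fin n) (Fin n) ℝ :=
  X * (Xᵀ * X)⁻¹ * Xᵀ

/-- The `j`-th cluster `C_j = {i : X i j = 1}` as a finset. -/
noncomputable def cluster {n k : ℕ} (X : Matrix (Fin n) (Fin k) ℝ) (j : Fin k) : Finset (Fin n) :=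
  Finset.univ.filter (fun i => X i j = 1)

theorem IsAssignment.transpose_mul_self {n k : ℕ} {X : Matrix (Fin n) (Fin k) ℝ}
    (hX : IsAssignment X) : Xᵀ * X = Matrix.diagonal (fun c => ∑ i, X i c) := by
  obtain ⟨h01, hrow, -⟩ := hX
  ext a b
  rw [Matrix.mul_apply, Matrix.diagonal_apply]
  split_ifs with hab
  · subst hab
    refine Finset.sum_congr rfl fun i _ => ?_
    rcases h01 i a with h | h <;> simp [h]
  · refine Finset.sum_eq_zero fun i _ => ?_
    have hle : X i a + X i b ≤ 1 := by
      rw [← hrow i, ← Finset.sum_pair hab]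
      refine Finset.sum_le_sum_of_subset_of_nonneg (Finset.subset_univ _) fun c _ _ => ?_
      rcases h01 i c with h | h <;> simp [h]
    rw [Matrix.transpose_apply]
    rcases h01 i a with ha | ha <;> rcases h01 i b with hb | hb <;> simp only [ha, hb] at hle ⊢ <;>
      linarith

theorem IsAssignment.clusterMat_apply {n k : ℕ} {X : Matrix (Fin n) (Fin k) ℝ}
    (hX : IsAssignment X) (i j : Fin n) :
    clusterMat X i j = ∑ c, X i c * (∑ l, X l c)⁻¹ * X j c := by
  have hinv : (Matrix.diagonal fun c => ∑ l, X l c)⁻¹ =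
      Matrix.diagonal fun c => (∑ l, X l c)⁻¹ := by
    refine Matrix.inv_eq_right_inv ?_
    rw [Matrix.diagonal_mul_diagonal, ← Matrix.diagonal_one]
    congr 1
    funext c
    exact mul_inv_cancel₀ (zero_lt_one.trans_le (hX.2.2 c)).ne'
  rw [clusterMat, hX.transpose_mul_self, hinv, Matrix.mul_apply]
  simp only [Matrix.mul_diagonal, Matrix.transpose_apply]

theorem IsAssignment.sum_col_le {n k : ℕ} {X : Matrix (Fin n) (Fin k) ℝ}
    (hX : IsAssignment X) (c : Fin k) : ∑ i, X i c ≤ (n : ℝ) - k + 1 := by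
  have htotal : ∑ c, ∑ i, X i c = n := by
    rw [Finset.sum_comm]
    simp [hX.2.1]
  have hle : ∑ i, X i c - 1 ≤ ∑ c, (∑ i, X i c - 1) :=
    Finset.single_le_sum (f := fun c => ∑ i, X i c - 1)
      (fun c _ => sub_nonneg.2 (hX.2.2 c)) (Finset.mem_univ c)
  rw [Finset.sum_sub_distrib, htotal] at hle
  simp only [Finset.sum_const, Finset.card_univ, Fintype.card_fin, nsmul_eq_mul, mul_one] at hle
  linarith

theorem IsAssignment.exists_eq_one {n k : ℕ} {X : Matrix (Fin n) (Fin k) ℝ}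
    (hX : IsAssignment X) (i : Fin n) : ∃ c, X i c = 1 := by
  by_contra! h
  have hzero : ∑ c, X i c = 0 :=
    Finset.sum_eq_zero fun c _ => (hX.1 i c).resolve_right (h c)
  exact zero_ne_one (hzero.symm.trans (hX.2.1 i))

/-- the clique inequalities: for every `I ⊆ [n]` with `|I| = k + 1`,
`∑_{(i,j) ∈ I×I, i<j} Z_{ij} ≥ 1/(n - k + 1)`. -/
theorem stmt_13 (n k : ℕ) (hk : 0 < k) (hkn : k < n)
    (X : Matrix (Fin n) (Fin k) ℝ) (hX : IsAssignment X) :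
    ∀ I : Finset (Fin n), I.card = k + 1 →
      1 / ((n : ℝ) - (k : ℝ) + 1) ≤
        ∑ i ∈ I, ∑ j ∈ I.filter (fun j => i < j), clusterMat X i j := by
  have hentry (i : Fin n) (c : Fin k) : 0 ≤ X i c := by
    rcases hX.1 i c with h | h <;> simp [h]
  have hterm (i j : Fin n) (c : Fin k) : 0 ≤ X i c * (∑ l, X l c)⁻¹ * X j c :=
    mul_nonneg (mul_nonneg (hentry i c)
      (inv_nonneg.2 (Finset.sum_nonneg fun l _ => hentry l c))) (hentry j c)
  have hnonneg (i j : Fin n) : 0 ≤ clusterMat X i j := by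
    rw [hX.clusterMat_apply]
    exact Finset.sum_nonneg fun c _ => hterm i j c
  have hsame {i j : Fin n} {c : Fin k} (hi : X i c = 1) (hj : X j c = 1) :
      1 / ((n : ℝ) - (k : ℝ) + 1) ≤ clusterMat X i j := by
    rw [hX.clusterMat_apply]
    calc 1 / ((n : ℝ) - (k : ℝ) + 1) ≤ 1 / ∑ l, X l c :=
          one_div_le_one_div_of_le (zero_lt_one.trans_le (hX.2.2 c)) (hX.sum_col_le c)
      _ = X i c * (∑ l, X l c)⁻¹ * X j c := by rw [hi, hj, one_mul, mul_one, one_div]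
      _ ≤ _ := Finset.single_le_sum (f := fun c => X i c * (∑ l, X l c)⁻¹ * X j c)
          (fun c _ => hterm i j c) (Finset.mem_univ c)
  intro I hI
  choose f hf using hX.exists_eq_one
  obtain ⟨i, hi, j, hj, hne, hfij⟩ :=
    Finset.exists_ne_map_eq_of_card_lt_of_maps_to (s := I) (t := Finset.univ) (f := f)
      (by simp [hI]) (fun _ _ => Finset.mem_coe.2 (Finset.mem_univ _))
  wlog hij : i < j generalizing i j
  · exact this j hj i hi hne.symm hfij.symm (lt_of_le_of_ne (not_lt.1 hij) hne.symm)
  calc 1 / ((n : ℝ) - (k : ℝ) + 1) ≤ clusterMat X i j := hsame (hf i) (hfij ▸ hf j)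
    _ ≤ ∑ j ∈ I.filter (fun j => i < j), clusterMat X i j :=
        Finset.single_le_sum (fun j _ => hnonneg i j) (Finset.mem_filter.2 ⟨hj, hij⟩)
    _ ≤ _ := Finset.single_le_sum
        (f := fun i => ∑ j ∈ I.filter (fun j => i < j), clusterMat X i j)
        (fun i _ => Finset.sum_nonneg fun j _ => hnonneg i j) hi
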